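/- For every real ε > 0 there exists a constant C = C(ε) such that for all integers q and K with 1 ≤ K ≤ q, the number J₂(q;K) of solutions (x₁, x₂, x₃, x₄) with 1 ≤ x_i ≤ K, each x_i coprime to q, of the congruence x₁⁻¹ + x₂⁻¹ ≡ x₃⁻¹ + x₄⁻¹ (mod q) (inverses taken modulo q) satisfies J₂(q;K) ≤ C (K^{7/2} q^{-1/2} + K²) q^ε. -/

import Mathlib

theorem Nat.exists_card_divisors_le_rpow {ε : ℝ} (hε : 0 < ε) :
    ∃ C : ℝ, 1 ≤ C ∧ ∀ n : ℕ, n ≠ 0 → (n.divisors.card : ℝ) ≤ C * (n : ℝ) ^ ε := by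
  have hlog : 0 < ε * Real.log 2 := mul_pos hε (Real.log_pos one_lt_two)
  set B : ℝ := 1 + 1 / (ε * Real.log 2)
  have hB : 1 ≤ B := le_add_of_nonneg_right (by positivity)
  obtain ⟨N, hN⟩ := exists_nat_ge ((2 : ℝ) ^ (1 / ε))
  refine ⟨B ^ N, one_le_pow₀ hB, fun n hn => ?_⟩
  have local_bound : ∀ p ∈ n.primeFactors, ((n.factorization p + 1 : ℕ) : ℝ) ≤
      (if p < N then B else 1) * ((p : ℝ) ^ (n.factorization p)) ^ ε := by
    intro p hp
    have hp2 : (2 : ℝ) ≤ p := by exact_mod_cast (Nat.prime_of_mem_primeFactors hp).two_le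
    generalize n.factorization p = v
    have hcomm : ((p : ℝ) ^ v) ^ ε = ((p : ℝ) ^ ε) ^ v := by
      rw [← Real.rpow_natCast, ← Real.rpow_natCast, ← Real.rpow_mul (by linarith),
        ← Real.rpow_mul (by linarith), mul_comm]
    split_ifs with h
    · have h1 : 1 + v * (ε * Real.log 2) ≤ ((p : ℝ) ^ v) ^ ε := by
        calc 1 + v * (ε * Real.log 2) ≤ Real.exp (v * (ε * Real.log 2)) := by
              linarith [Real.add_one_le_exp (v * (ε * Real.log 2))]
          _ = ((2 : ℝ) ^ v) ^ ε := by
              rw [← Real.rpow_natCast, ← Real.rpow_mul (by norm_num),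
                Real.rpow_def_of_pos (by norm_num)]
              ring_nf
          _ ≤ _ := by gcongr
      calc ((v + 1 : ℕ) : ℝ) ≤ B * (1 + v * (ε * Real.log 2)) := by
            have : B * (1 + v * (ε * Real.log 2))
                = 1 + v + (v * (ε * Real.log 2) + 1 / (ε * Real.log 2)) := by
              simp only [B]; field_simp; ring
            rw [this]; push_cast
            have : 0 ≤ v * (ε * Real.log 2) + 1 / (ε * Real.log 2) := by positivity
            linarith
        _ ≤ _ := by gcongr
    · rw [one_mul, hcomm]
      have h2 : (2 : ℝ) ≤ (p : ℝ) ^ ε := by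
        calc (2 : ℝ) = ((2 : ℝ) ^ (1 / ε)) ^ ε := by
              rw [← Real.rpow_mul (by norm_num), one_div_mul_cancel hε.ne', Real.rpow_one]
          _ ≤ _ := by
              gcongr
              exact hN.trans (by exact_mod_cast not_lt.mp h)
      calc ((v + 1 : ℕ) : ℝ) ≤ 2 ^ v := by exact_mod_cast Nat.lt_two_pow_self
        _ ≤ _ := by gcongr
  rw [Nat.card_divisors hn, Nat.cast_prod]
  refine (Finset.prod_le_prod (fun _ _ => by positivity) local_bound).trans ?_
  rw [Finset.prod_mul_distrib]
  have hprod : ∏ p ∈ n.primeFactors, ((p : ℝ) ^ (n.factorization p)) ^ ε = (n : ℝ) ^ ε := by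
    rw [Real.finsetProd_rpow _ _ (fun _ _ => by positivity)]
    congr 1
    have := Nat.prod_factorization_pow_eq_self hn
    conv_rhs => rw [← this]
    simp [Finsupp.prod]
  rw [hprod]
  gcongr
  rw [Finset.prod_ite, Finset.prod_const, Finset.prod_const_one, mul_one]
  refine pow_le_pow_right₀ hB ?_
  calc _ ≤ (Finset.range N).card := Finset.card_le_card fun p => by simp
    _ = N := Finset.card_range N

/-- Pairs `(x₁, x₂)` of integers in `[1, K]` coprime to `q`. -/
def coprimePairs (q K : ℕ) : Finset (ℕ × ℕ) :=
  {x ∈ Finset.Icc 1 K ×ˢ Finset.Icc 1 K | x.1.Coprime q ∧ x.2.Coprime q}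

/-- The sum of the reciprocals modulo `q` of the two entries. -/
def reciprocalSum (q : ℕ) (x : ℕ × ℕ) : ZMod q := (x.1 : ZMod q)⁻¹ + (x.2 : ZMod q)⁻¹

theorem mem_coprimePairs {q K : ℕ} {x : ℕ × ℕ} :
    x ∈ coprimePairs q K ↔ (1 ≤ x.1 ∧ x.1 ≤ K ∧ x.1.Coprime q) ∧
      (1 ≤ x.2 ∧ x.2 ≤ K ∧ x.2.Coprime q) := by
  simp only [coprimePairs, Finset.mem_filter, Finset.mem_product, Finset.mem_Icc]
  tauto

theorem reciprocalSum_mul {q K : ℕ} {x : ℕ × ℕ} (hx : x ∈ coprimePairs q K) :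
    reciprocalSum q x * (x.1 * x.2) = x.1 + x.2 := by
  obtain ⟨⟨-, -, h1⟩, -, -, h2⟩ := mem_coprimePairs.1 hx
  have e1 := ZMod.coe_mul_inv_eq_one x.1 h1
  have e2 := ZMod.coe_mul_inv_eq_one x.2 h2
  unfold reciprocalSum
  linear_combination (x.2 : ZMod q) * e1 + (x.1 : ZMod q) * e2

theorem eq_of_natCast_inv_eq {q K m n : ℕ} (hK : K ≤ q) (hm : 1 ≤ m ∧ m ≤ K ∧ m.Coprime q)
    (hn : 1 ≤ n ∧ n ≤ K ∧ n.Coprime q) (h : (m : ZMod q)⁻¹ = (n : ZMod q)⁻¹) : m = n := by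
  have e1 := ZMod.coe_mul_inv_eq_one m hm.2.2
  have e2 := ZMod.coe_mul_inv_eq_one n hn.2.2
  rw [h] at e1
  have e : (m : ZMod q) = n := by
    linear_combination (n : ZMod q) * e1 - (m : ZMod q) * e2
  have hd := (ZMod.intCast_eq_intCast_iff_dvd_sub m n q).1 (by exact_mod_cast e)
  have := Int.eq_zero_of_abs_lt_dvd hd (by rw [abs_lt]; omega)
  omega

theorem eq_of_reciprocalSum_eq {q K : ℕ} (hK : K ≤ q) {x y : ℕ × ℕ} (hx : x ∈ coprimePairs q K)
    (hy : y ∈ coprimePairs q K) (h : reciprocalSum q x = reciprocalSum q y)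
    (h' : x.1 = y.1 ∨ x.2 = y.2) : x = y := by
  rw [mem_coprimePairs] at hx hy
  unfold reciprocalSum at h
  rcases h' with h' | h'
  · rw [h', add_right_inj] at h
    exact Prod.ext h' (eq_of_natCast_inv_eq hK hx.2 hy.2 h)
  · rw [h', add_left_inj] at h
    exact Prod.ext (eq_of_natCast_inv_eq hK hx.1 hy.1 h) h'

theorem card_le_of_dvd_of_injOn {ι : Type*} {S : Finset ι} {n : ℤ} (hn : n ≠ 0) (f : ι → ℤ)
    (hf : ∀ x ∈ S, f x ∣ n) (hinj : Set.InjOn f S) :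
    S.card ≤ 2 * n.natAbs.divisors.card := by
  have hsub : S.image f ⊆ n.natAbs.divisors.image (fun d : ℕ => (d : ℤ)) ∪
      n.natAbs.divisors.image (fun d : ℕ => -(d : ℤ)) := by
    intro d hd
    obtain ⟨x, hx, rfl⟩ := Finset.mem_image.1 hd
    have hdvd := Nat.mem_divisors.2 ⟨Int.natAbs_dvd_natAbs.2 (hf x hx), Int.natAbs_ne_zero.2 hn⟩
    rw [Finset.mem_union, Finset.mem_image, Finset.mem_image]
    rcases Int.natAbs_eq (f x) with h | h
    · exact .inl ⟨_, hdvd, h.symm⟩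
    · exact .inr ⟨_, hdvd, h.symm⟩
  calc S.card = (S.image f).card := (Finset.card_image_of_injOn hinj).symm
    _ ≤ _ := Finset.card_le_card hsub
    _ ≤ _ := Finset.card_union_le _ _
    _ ≤ n.natAbs.divisors.card + n.natAbs.divisors.card :=
      add_le_add Finset.card_image_le Finset.card_image_le
    _ = _ := (two_mul _).symm

/-- Solutions of `reciprocalSum q x = s` lying on a fixed conic `a (x₁ + x₂) - u x₁ x₂ = k q`
correspond to divisors of `a² - u k q`. -/
theorem card_reciprocalSum_eq_conic_le {q K D : ℕ} (hK : K ≤ q) (hD : 1 ≤ D)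
    (hdiv : ∀ n : ℕ, n ≠ 0 → n ≤ 4 * q ^ 4 → n.divisors.card ≤ D) (s : ZMod q) {a u : ℤ}
    (hu : u ≠ 0) (haq : |a| ≤ q) (huq : |u| ≤ q) (k : ℤ) :
    Finset.card {x ∈ coprimePairs q K | reciprocalSum q x = s ∧
      a * (x.1 + x.2) - u * (x.1 * x.2) = k * q} ≤ 2 * D := by
  have factor : ∀ x : ℕ × ℕ, a * (x.1 + x.2) - u * (x.1 * x.2) = k * q →
      (u * x.1 - a) * (u * x.2 - a) = a ^ 2 - u * (k * q) := by
    intro x hx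
    linear_combination -u * hx
  set S := Finset.filter (fun x : ℕ × ℕ => reciprocalSum q x = s ∧
      a * (x.1 + x.2) - u * (x.1 * x.2) = k * q) (coprimePairs q K)
  have hS : ∀ x ∈ S, ∀ y ∈ S, x.1 = y.1 ∨ x.2 = y.2 → x = y := by
    intro x hx y hy
    obtain ⟨hx, hxs, -⟩ := Finset.mem_filter.1 hx
    obtain ⟨hy, hys, -⟩ := Finset.mem_filter.1 hy
    exact eq_of_reciprocalSum_eq hK hx hy (hxs.trans hys.symm)
  by_cases hn : a ^ 2 - u * (k * q) = 0
  · calc S.card ≤ (Finset.univ : Finset Bool).card := by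
          refine Finset.card_le_card_of_injOn (fun x => decide (u * x.1 = a))
            (fun _ _ => Finset.mem_coe.2 (Finset.mem_univ _)) ?_
          intro x hx y hy hxy
          have hx0 := factor x (Finset.mem_filter.1 hx).2.2
          have hy0 := factor y (Finset.mem_filter.1 hy).2.2
          rw [hn, mul_eq_zero, sub_eq_zero, sub_eq_zero] at hx0 hy0
          have hxy' : u * x.1 = a ↔ u * y.1 = a := by simpa using hxy
          refine hS x hx y hy ?_
          by_cases h : u * x.1 = a
          · left
            exact_mod_cast mul_left_cancel₀ hu (h.trans (hxy'.1 h).symm)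
          · right
            exact_mod_cast mul_left_cancel₀ hu
              ((hx0.resolve_left h).trans (hy0.resolve_left (hxy'.not.1 h)).symm)
      _ ≤ 2 * D := by simpa using hD
  · rcases S.eq_empty_or_nonempty with hem | ⟨z, hz⟩
    · simp [hem]
    refine (card_le_of_dvd_of_injOn hn (fun x => u * x.1 - a) ?_ ?_).trans ?_
    · intro x hx
      exact ⟨_, (factor x (Finset.mem_filter.1 hx).2.2).symm⟩
    · intro x hx y hy hxy
      refine hS x hx y hy (.inl ?_)
      exact_mod_cast mul_left_cancel₀ hu (sub_left_injective hxy)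
    · refine Nat.mul_le_mul_left 2 (hdiv _ (Int.natAbs_ne_zero.2 hn) ?_)
      obtain ⟨hzm, -, hzq⟩ := Finset.mem_filter.1 hz
      obtain ⟨⟨h1, h1K, -⟩, h2, h2K, -⟩ := mem_coprimePairs.1 hzm
      have hq : (1 : ℤ) ≤ q := by omega
      have hbd : ∀ m : ℕ, m ≤ K → |u * m - a| ≤ 2 * (q : ℤ) ^ 2 := by
        intro m hm
        calc |u * m - a| ≤ |u * m| + |a| := abs_sub _ _
          _ = |u| * m + |a| := by rw [abs_mul, Nat.abs_cast]
          _ ≤ q * q + q := by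
            gcongr
            omega
          _ ≤ _ := by nlinarith
      have : ((a ^ 2 - u * (k * q)).natAbs : ℤ) ≤ 4 * (q : ℤ) ^ 4 := by
        rw [Int.natCast_natAbs, ← factor z hzq, abs_mul]
        calc _ ≤ (2 * (q : ℤ) ^ 2) * (2 * (q : ℤ) ^ 2) := by
              gcongr
              exacts [hbd _ h1K, hbd _ h2K]
          _ = _ := by ring
      exact_mod_cast this

theorem card_reciprocalSum_eq_le {q K D : ℕ} (hq : 0 < q) (hK : K ≤ q) (hD : 1 ≤ D)
    (hdiv : ∀ n : ℕ, n ≠ 0 → n ≤ 4 * q ^ 4 → n.divisors.card ≤ D) {s : ZMod q} {a u : ℤ}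
    (hu : u ≠ 0) (has : (a : ZMod q) * s = u) (haq : |a| ≤ q) (huq : |u| ≤ q) :
    (Finset.card {x ∈ coprimePairs q K | reciprocalSum q x = s} : ℝ) ≤
      2 * D * (2 * ((|a| * (2 * K) + |u| * K ^ 2) / q) + 1) := by
  set M : ℕ := (a.natAbs * (2 * K) + u.natAbs * K ^ 2) / q with hM
  have hcard := Finset.card_le_mul_card_image_of_maps_to
    (s := {x ∈ coprimePairs q K | reciprocalSum q x = s}) (t := Finset.Icc (-(M : ℤ)) M)
    (f := fun x => (a * (x.1 + x.2) - u * (x.1 * x.2)) / q) ?_ (2 * D) ?_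
  · rw [Int.card_Icc, show ((M : ℤ) + 1 - -(M : ℤ)).toNat = 2 * M + 1 by omega] at hcard
    have hMr : (M : ℝ) ≤ (|a| * (2 * K) + |u| * K ^ 2) / q := by
      refine Nat.cast_div_le.trans (le_of_eq ?_)
      simp [Nat.cast_natAbs]
    calc _ ≤ ((2 * D * (2 * M + 1) : ℕ) : ℝ) := by exact_mod_cast hcard
      _ = 2 * D * (2 * M + 1) := by push_cast; ring
      _ ≤ _ := by gcongr
  all_goals
    have hdvd : ∀ x ∈ coprimePairs q K, reciprocalSum q x = s →
        (q : ℤ) ∣ a * (x.1 + x.2) - u * (x.1 * x.2) := by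
      rintro x hx rfl
      rw [← ZMod.intCast_zmod_eq_zero_iff_dvd]
      push_cast
      rw [← has, ← reciprocalSum_mul hx]
      ring
  · intro x hx
    obtain ⟨hx, hxs⟩ := Finset.mem_filter.1 hx
    obtain ⟨k, hk⟩ := hdvd x hx hxs
    obtain ⟨⟨-, h1, -⟩, -, h2, -⟩ := mem_coprimePairs.1 hx
    have hq' : (q : ℤ) ≠ 0 := by omega
    have hkM : k.natAbs ≤ M := by
      rw [hM, Nat.le_div_iff_mul_le hq]
      zify
      calc |k| * q = |a * (x.1 + x.2) - u * (x.1 * x.2)| := by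
            rw [hk, abs_mul, Nat.abs_cast, mul_comm]
        _ ≤ |a * (x.1 + x.2)| + |u * (x.1 * x.2)| := abs_sub _ _
        _ = |a| * (x.1 + x.2) + |u| * (x.1 * x.2) := by
            rw [abs_mul, abs_mul, abs_of_nonneg (by positivity : (0 : ℤ) ≤ x.1 + x.2),
              abs_of_nonneg (by positivity : (0 : ℤ) ≤ x.1 * x.2)]
        _ ≤ |a| * (K + K) + |u| * (K * K) := by gcongr
        _ = _ := by ring
    simp only [hk, Int.mul_ediv_cancel_left _ hq', Finset.mem_Icc]
    omega
  · intro k _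
    refine le_trans (Finset.card_le_card ?_)
      (card_reciprocalSum_eq_conic_le hK hD hdiv s hu haq huq k)
    intro x hx
    obtain ⟨hx, hxk⟩ := Finset.mem_filter.1 hx
    obtain ⟨hx, hxs⟩ := Finset.mem_filter.1 hx
    refine Finset.mem_filter.2 ⟨hx, hxs, ?_⟩
    rw [← hxk, Int.ediv_mul_cancel (hdvd x hx hxs)]

/-- The linear congruence `a s ≡ u (mod q)` has a solution with `u ≠ 0` in which `a` and `u` are
simultaneously small, except that `u` may be as large as `gcd(s, q)`. -/
theorem exists_mul_eq_intCast {q K : ℕ} (hK1 : 1 ≤ K) (hK : K ≤ q) (s : ZMod q) :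
    ∃ a u : ℤ, u ≠ 0 ∧ (a : ZMod q) * s = u ∧ |a| ≤ q ∧ |u| ≤ q ∧
      (|a| * (2 * K) + |u| * K ^ 2 : ℝ) / q ≤
        3 * (K * (√K / √q)) + (s.val.gcd q : ℝ) * K ^ 2 / q := by
  have hq : 0 < q := by omega
  have : NeZero q := ⟨hq.ne'⟩
  have hqr : (0 : ℝ) < q := by exact_mod_cast hq
  have hKr : (1 : ℝ) ≤ K := by exact_mod_cast hK1
  have hKq : (K : ℝ) ≤ q := by exact_mod_cast hK
  have hk : 0 < √(K : ℝ) := Real.sqrt_pos.2 (by linarith)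
  have hr : 0 < √(q : ℝ) := Real.sqrt_pos.2 hqr
  have hk2 : √(K : ℝ) ^ 2 = K := Real.sq_sqrt (by linarith)
  have hr2 : √(q : ℝ) ^ 2 = q := Real.sq_sqrt hqr.le
  have hkr : √(K : ℝ) ≤ √q := Real.sqrt_le_sqrt hKq
  have hk1 : 1 ≤ √(K : ℝ) := Real.one_le_sqrt.2 hKr
  set T : ℝ := √K * √q with hT
  have hT1 : 1 ≤ T := one_le_mul_of_one_le_of_one_le hk1 (hk1.trans hkr)
  have hTq : T ≤ q := by
    calc T ≤ √q * √q := by rw [hT]; gcongr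
      _ = q := by rw [← sq, hr2]
  have hTK : T * (2 * K) / q = 2 * (K * (√K / √q)) := by
    rw [hT]; nth_rewrite 2 [← hr2]; field_simp
  have hTK' : q / T * K ^ 2 / q = K * (√K / √q) := by
    rw [hT, div_mul_eq_mul_div, div_div, mul_comm (q : ℝ), mul_div_mul_right _ _ hqr.ne']
    nth_rewrite 1 [← hk2]
    field_simp
    rw [hk2]
  have hs : ((s.val : ℤ) : ZMod q) = s := by simp
  obtain ⟨j, a, ha0, haT, haj⟩ := Real.exists_int_int_abs_mul_sub_le ((s.val : ℝ) / q)
    (Nat.floor_pos.2 hT1)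
  have haT' : (a : ℝ) ≤ T :=
    (by exact_mod_cast haT : (a : ℝ) ≤ (⌊T⌋₊ : ℝ)).trans (Nat.floor_le (by linarith))
  set u : ℤ := a * s.val - j * q with hu
  have hau : (a : ZMod q) * s = u := by
    rw [hu]; push_cast; simp
  by_cases hu0 : u = 0
  · set g := s.val.gcd q
    have hg : 0 < g := Nat.gcd_pos_of_pos_right _ hq
    obtain ⟨t, ht⟩ : g ∣ q := Nat.gcd_dvd_right _ _
    obtain ⟨v, hv⟩ : g ∣ s.val := Nat.gcd_dvd_left _ _
    have ht0 : 0 < t := Nat.pos_of_ne_zero (by rintro rfl; omega)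
    have hta : (t : ℤ) ∣ a := by
      have hcop : IsCoprime (t : ℤ) v := by
        rw [Nat.isCoprime_iff_coprime, Nat.coprime_comm]
        refine Nat.eq_of_mul_eq_mul_left hg ?_
        rw [← Nat.gcd_mul_left, ← hv, ← ht, mul_one]
      refine hcop.dvd_of_dvd_mul_right ⟨j, ?_⟩
      have hg' : (g : ℤ) ≠ 0 := by omega
      refine mul_left_cancel₀ hg' ?_
      have h1 : (q : ℤ) = g * t := by exact_mod_cast ht
      have h2 : (s.val : ℤ) = g * v := by exact_mod_cast hv
      rw [h1, h2] at hu
      linear_combination hu0 - hu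
    have htT : (t : ℝ) ≤ T := le_trans (by exact_mod_cast Int.le_of_dvd ha0 hta) haT'
    have hts : (t : ZMod q) * s = 0 := by
      rw [← hs, hv]
      have : (q : ZMod q) = g * t := by exact_mod_cast congrArg (Nat.cast (R := ZMod q)) ht
      rw [ZMod.natCast_self] at this
      push_cast
      linear_combination -(v : ZMod q) * this
    have hb0 := Int.emod_nonneg (s.val.gcdA q) (by omega : (t : ℤ) ≠ 0)
    have hbt := (Int.emod_lt_of_pos (s.val.gcdA q) (by omega : (0 : ℤ) < t)).le
    have hbs : ((s.val.gcdA q % t : ℤ) : ZMod q) * s = (g : ℤ) := by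
      have h1 := congrArg (Int.cast (R := ZMod q)) (Nat.gcd_eq_gcd_ab s.val q)
      push_cast at h1
      rw [ZMod.natCast_self, ZMod.natCast_zmod_val] at h1
      rw [Int.emod_def]
      push_cast
      linear_combination -h1 - ((s.val.gcdA q / t : ℤ) : ZMod q) * hts
    set b := s.val.gcdA q % t
    have hbT : ((|b| : ℤ) : ℝ) ≤ T := by
      rw [abs_of_nonneg hb0]
      exact le_trans (by exact_mod_cast hbt) htT
    refine ⟨b, g, by omega, hbs, ?_, ?_, ?_⟩
    · exact_mod_cast hbT.trans hTq
    · rw [Nat.abs_cast]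
      exact_mod_cast Nat.le_of_dvd hq ⟨t, ht⟩
    · rw [add_div]
      push_cast at hbT ⊢
      rw [abs_of_nonneg (by positivity : (0 : ℝ) ≤ g)]
      gcongr
      calc |(b : ℝ)| * (2 * K) / q ≤ T * (2 * K) / q := by gcongr
        _ = _ := hTK
        _ ≤ _ := by gcongr; norm_num
  · have hua : ((|u| : ℤ) : ℝ) ≤ q / T := by
      have h1 : (u : ℝ) = q * (a * (s.val / q) - j) := by
        rw [hu]; push_cast; field_simp
      rw [Int.cast_abs, h1, abs_mul, abs_of_pos hqr, div_eq_mul_one_div (q : ℝ) T]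
      refine mul_le_mul_of_nonneg_left
        (haj.trans (one_div_le_one_div_of_le (zero_lt_one.trans_le hT1) ?_)) hqr.le
      exact (Nat.lt_floor_add_one T).le
    have haT'' : ((|a| : ℤ) : ℝ) ≤ T := by rwa [abs_of_pos ha0]
    refine ⟨a, u, hu0, hau, ?_, ?_, ?_⟩
    · exact_mod_cast haT''.trans hTq
    · exact_mod_cast hua.trans (div_le_self hqr.le hT1)
    · push_cast at haT'' hua ⊢
      calc (|(a : ℝ)| * (2 * K) + |(u : ℝ)| * K ^ 2) / q
          ≤ (T * (2 * K) + q / T * K ^ 2) / q := by gcongr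
        _ = 3 * (K * (√K / √q)) := by rw [add_div, hTK, hTK']; ring
        _ ≤ _ := le_add_of_nonneg_right (by positivity)

theorem sum_gcd_reciprocalSum_le {q K : ℕ} (hq : 0 < q) :
    ∑ x ∈ coprimePairs q K, (reciprocalSum q x).val.gcd q ≤ 2 * K ^ 2 * q.divisors.card := by
  have : NeZero q := ⟨hq.ne'⟩
  have hle : ∀ x ∈ coprimePairs q K, (reciprocalSum q x).val.gcd q ≤
      ∑ d ∈ q.divisors, if d ∣ x.1 + x.2 then d else 0 := by
    intro x hx
    set g := (reciprocalSum q x).val.gcd q with hg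
    have hgq : g ∣ q := Nat.gcd_dvd_right _ _
    have hmod : (reciprocalSum q x).val * (x.1 * x.2) ≡ x.1 + x.2 [MOD q] := by
      rw [← ZMod.natCast_eq_natCast_iff]
      push_cast
      rw [ZMod.natCast_zmod_val, reciprocalSum_mul hx]
    have hgx : g ∣ x.1 + x.2 :=
      ((hmod.of_dvd hgq).dvd_iff dvd_rfl).1 ((Nat.gcd_dvd_left _ _).mul_right _)
    calc g = if g ∣ x.1 + x.2 then g else 0 := (if_pos hgx).symm
      _ ≤ _ := Finset.single_le_sum (f := fun d => if d ∣ x.1 + x.2 then d else 0)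
        (fun _ _ => Nat.zero_le _) (Nat.mem_divisors.2 ⟨hgq, hq.ne'⟩)
  have hinner : ∀ d m : ℕ, m ≤ K →
      (∑ n ∈ Finset.Icc 1 K, if d ∣ m + n then d else 0) ≤ 2 * K := by
    intro d m hm
    rw [← Finset.sum_filter, Finset.sum_const, smul_eq_mul]
    have hc : Finset.card {n ∈ Finset.Icc 1 K | d ∣ m + n} ≤ 2 * K / d := by
      rw [← Nat.Ioc_filter_dvd_card_eq_div]
      refine Finset.card_le_card_of_injOn (m + ·) ?_ (add_right_injective m).injOn
      intro n hn
      simp only [Finset.coe_filter, Finset.mem_Icc, Finset.mem_Ioc, Set.mem_ofPred_eq] at hn ⊢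
      exact ⟨by omega, hn.2⟩
    exact (Nat.mul_le_mul_right d hc).trans (Nat.div_mul_le_self _ _)
  calc _ ≤ ∑ x ∈ coprimePairs q K, ∑ d ∈ q.divisors, (if d ∣ x.1 + x.2 then d else 0) :=
        Finset.sum_le_sum hle
    _ ≤ ∑ x ∈ Finset.Icc 1 K ×ˢ Finset.Icc 1 K, ∑ d ∈ q.divisors,
          (if d ∣ x.1 + x.2 then d else 0) :=
        Finset.sum_le_sum_of_subset (Finset.filter_subset _ _)
    _ = ∑ d ∈ q.divisors, ∑ m ∈ Finset.Icc 1 K, ∑ n ∈ Finset.Icc 1 K,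
          (if d ∣ m + n then d else 0) := by
        rw [Finset.sum_comm]
        simp only [Finset.sum_product]
    _ ≤ ∑ d ∈ q.divisors, ∑ m ∈ Finset.Icc 1 K, 2 * K :=
        Finset.sum_le_sum fun d _ => Finset.sum_le_sum fun m hm =>
          hinner d m (Finset.mem_Icc.1 hm).2
    _ = _ := by
        simp only [Finset.sum_const, Nat.card_Icc, smul_eq_mul, Nat.add_sub_cancel]
        ring

theorem sum_card_reciprocalSum_eq_le {q K D : ℕ} (hK1 : 1 ≤ K) (hK : K ≤ q) (hD : 1 ≤ D)
    (hdiv : ∀ n : ℕ, n ≠ 0 → n ≤ 4 * q ^ 4 → n.divisors.card ≤ D) :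
    (∑ x ∈ coprimePairs q K,
      (Finset.card {y ∈ coprimePairs q K | reciprocalSum q y = reciprocalSum q x} : ℝ)) ≤
      20 * D ^ 2 * (K ^ 3 * (√K / √q) + K ^ 2) := by
  have hq : 0 < q := by omega
  have hqr : (0 : ℝ) < q := by exact_mod_cast hq
  have hDr : (1 : ℝ) ≤ D := by exact_mod_cast hD
  have hKq : (K : ℝ) ≤ q := by exact_mod_cast hK
  set R : ℝ := √K / √q with hR
  have hR0 : 0 ≤ R := by positivity
  have hKR : (K : ℝ) / q ≤ R := by
    have h1 : R ^ 2 = K / q := by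
      rw [hR, div_pow, Real.sq_sqrt (by positivity), Real.sq_sqrt (by positivity)]
    have h2 : R ≤ 1 := div_le_one_of_le₀ (Real.sqrt_le_sqrt hKq) (by positivity)
    nlinarith
  have hpoint : ∀ x ∈ coprimePairs q K,
      (Finset.card {y ∈ coprimePairs q K | reciprocalSum q y = reciprocalSum q x} : ℝ) ≤
        2 * D * (6 * (K * R) + 1) +
          4 * D * K ^ 2 / q * ((reciprocalSum q x).val.gcd q : ℝ) := by
    intro x _
    obtain ⟨a, u, hu, has, haq, huq, hb⟩ := exists_mul_eq_intCast hK1 hK (reciprocalSum q x)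
    have h := card_reciprocalSum_eq_le hq hK hD hdiv hu has haq huq
    push_cast at h hb
    calc _ ≤ _ := h
      _ ≤ 2 * D * (2 * (3 * (K * R) + ((reciprocalSum q x).val.gcd q : ℝ) * K ^ 2 / q) + 1) := by
        gcongr
      _ = _ := by ring
  have hcard : ((coprimePairs q K).card : ℝ) ≤ K ^ 2 := by
    have := Finset.card_filter_le (Finset.Icc 1 K ×ˢ Finset.Icc 1 K)
      (fun x : ℕ × ℕ => x.1.Coprime q ∧ x.2.Coprime q)
    rw [Finset.card_product, Nat.card_Icc, Nat.add_sub_cancel, ← sq] at this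
    exact_mod_cast this
  have hgcd : (∑ x ∈ coprimePairs q K, ((reciprocalSum q x).val.gcd q : ℝ)) ≤
      2 * K ^ 2 * D := by
    have h1 : q.divisors.card ≤ D :=
      hdiv q hq.ne' (by nlinarith [Nat.le_self_pow (by norm_num : 4 ≠ 0) q])
    exact_mod_cast (sum_gcd_reciprocalSum_le hq).trans (Nat.mul_le_mul_left _ h1)
  calc _ ≤ _ := Finset.sum_le_sum hpoint
    _ = (coprimePairs q K).card * (2 * D * (6 * (K * R) + 1)) +
        4 * D * K ^ 2 / q * ∑ x ∈ coprimePairs q K, ((reciprocalSum q x).val.gcd q : ℝ) := by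
      rw [Finset.sum_add_distrib, Finset.sum_const, nsmul_eq_mul, ← Finset.mul_sum]
    _ ≤ K ^ 2 * (2 * D * (6 * (K * R) + 1)) + 4 * D * K ^ 2 / q * (2 * K ^ 2 * D) := by
      gcongr
    _ = 12 * D * (K ^ 3 * R) + 2 * D * K ^ 2 + 8 * D ^ 2 * (K ^ 3 * (K / q)) := by ring
    _ ≤ 12 * D ^ 2 * (K ^ 3 * R) + 2 * D ^ 2 * K ^ 2 + 8 * D ^ 2 * (K ^ 3 * R) := by
      have : (D : ℝ) ≤ D ^ 2 := by nlinarith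
      gcongr
    _ ≤ _ := by
      have : 0 ≤ (D : ℝ) ^ 2 * K ^ 2 := by positivity
      nlinarith

/-- Lemma (Heath-Brown): for every `ε > 0` there is a constant `C` such that for all
`1 ≤ K ≤ q`, the number `J₂(q;K)` of quadruples `(x₁,x₂,x₃,x₄)` with `1 ≤ xᵢ ≤ K`, each `xᵢ`
coprime to `q`, and `x₁⁻¹ + x₂⁻¹ ≡ x₃⁻¹ + x₄⁻¹ (mod q)`, satisfies
`J₂(q;K) ≤ C (K^{7/2} q^{-1/2} + K²) q^ε`. -/
theorem reciprocal_congruence_count_bound (ε : ℝ) (hε : 0 < ε) :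
    ∃ C : ℝ, ∀ q K : ℕ, 1 ≤ K → K ≤ q →
      (Set.ncard {x : ℕ × ℕ × ℕ × ℕ |
          (1 ≤ x.1 ∧ x.1 ≤ K ∧ Nat.Coprime x.1 q) ∧
          (1 ≤ x.2.1 ∧ x.2.1 ≤ K ∧ Nat.Coprime x.2.1 q) ∧
          (1 ≤ x.2.2.1 ∧ x.2.2.1 ≤ K ∧ Nat.Coprime x.2.2.1 q) ∧
          (1 ≤ x.2.2.2 ∧ x.2.2.2 ≤ K ∧ Nat.Coprime x.2.2.2 q) ∧
          (x.1 : ZMod q)⁻¹ + (x.2.1 : ZMod q)⁻¹ =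
            (x.2.2.1 : ZMod q)⁻¹ + (x.2.2.2 : ZMod q)⁻¹} : ℝ) ≤
        C * ((K : ℝ) ^ ((7 : ℝ) / 2) * (q : ℝ) ^ (-(1 : ℝ) / 2) + (K : ℝ) ^ 2) *
          (q : ℝ) ^ ε := by
  obtain ⟨C, hC1, hC⟩ := Nat.exists_card_divisors_le_rpow (ε := ε / 8) (by positivity)
  refine ⟨20 * (C * 4 ^ (ε / 8)) ^ 2, fun q K hK1 hK => ?_⟩
  have hq : 0 < q := by omega
  have hqr : (1 : ℝ) ≤ q := by exact_mod_cast hq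
  have hK0 : (0 : ℝ) < K := by exact_mod_cast hK1
  set B : ℝ := C * (4 * (q : ℝ) ^ 4) ^ (ε / 8) with hB
  have hB1 : 1 ≤ B := by
    refine one_le_mul_of_one_le_of_one_le hC1 (Real.one_le_rpow ?_ (by positivity))
    linarith [one_le_pow₀ hqr (n := 4)]
  have hB2 : B ^ 2 = (C * 4 ^ (ε / 8)) ^ 2 * (q : ℝ) ^ ε := by
    have : (((q : ℝ) ^ 4) ^ (ε / 8)) ^ 2 = (q : ℝ) ^ ε := by
      rw [← Real.rpow_natCast, ← Real.rpow_natCast, ← Real.rpow_mul (by positivity),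
        ← Real.rpow_mul (by positivity)]
      congr 1
      push_cast
      ring
    rw [hB, Real.mul_rpow (by norm_num) (by positivity), ← this]
    ring
  have hdiv : ∀ n : ℕ, n ≠ 0 → n ≤ 4 * q ^ 4 → n.divisors.card ≤ ⌊B⌋₊ := by
    intro n hn hnq
    refine Nat.le_floor ((hC n hn).trans ?_)
    have : (n : ℝ) ≤ 4 * (q : ℝ) ^ 4 := by exact_mod_cast hnq
    rw [hB]
    gcongr
  have hset : {x : ℕ × ℕ × ℕ × ℕ |
          (1 ≤ x.1 ∧ x.1 ≤ K ∧ Nat.Coprime x.1 q) ∧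
          (1 ≤ x.2.1 ∧ x.2.1 ≤ K ∧ Nat.Coprime x.2.1 q) ∧
          (1 ≤ x.2.2.1 ∧ x.2.2.1 ≤ K ∧ Nat.Coprime x.2.2.1 q) ∧
          (1 ≤ x.2.2.2 ∧ x.2.2.2 ≤ K ∧ Nat.Coprime x.2.2.2 q) ∧
          (x.1 : ZMod q)⁻¹ + (x.2.1 : ZMod q)⁻¹ =
            (x.2.2.1 : ZMod q)⁻¹ + (x.2.2.2 : ZMod q)⁻¹}.ncard =
      ∑ x ∈ coprimePairs q K,
        Finset.card {y ∈ coprimePairs q K | reciprocalSum q y = reciprocalSum q x} := by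
    rw [← Finset.card_sigma, ← Set.ncard_coe_finset]
    refine Set.ncard_congr (fun x _ => ⟨(x.1, x.2.1), x.2.2⟩) ?_ ?_ ?_
    · intro x hx
      simp only [Finset.mem_coe, Finset.mem_sigma, Finset.mem_filter, mem_coprimePairs]
      exact ⟨⟨hx.1, hx.2.1⟩, ⟨hx.2.2.1, hx.2.2.2.1⟩, hx.2.2.2.2.symm⟩
    · rintro ⟨x₁, x₂, x₃, x₄⟩ ⟨y₁, y₂, y₃, y₄⟩ - - h
      simp_all
    · rintro ⟨⟨x₁, x₂⟩, x₃, x₄⟩ hx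
      simp only [Finset.mem_coe, Finset.mem_sigma, Finset.mem_filter, mem_coprimePairs] at hx
      exact ⟨(x₁, x₂, x₃, x₄), ⟨hx.1.1, hx.1.2, hx.2.1.1, hx.2.1.2, hx.2.2.symm⟩, rfl⟩
  have hpow : (K : ℝ) ^ 3 * (√K / √q) = (K : ℝ) ^ ((7 : ℝ) / 2) * (q : ℝ) ^ (-(1 : ℝ) / 2) := by
    rw [Real.sqrt_eq_rpow, Real.sqrt_eq_rpow, neg_div, Real.rpow_neg (by positivity),
      ← div_eq_mul_inv, ← mul_div_assoc, ← Real.rpow_natCast, ← Real.rpow_add hK0]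
    norm_num
  rw [hset]
  push_cast
  calc _ ≤ _ := sum_card_reciprocalSum_eq_le hK1 hK (Nat.floor_pos.2 hB1) hdiv
    _ ≤ 20 * B ^ 2 * (K ^ 3 * (√K / √q) + K ^ 2) := by
      gcongr
      exact Nat.floor_le (by linarith)
    _ = _ := by
      rw [hB2, hpow]
      ring
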